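/- arXiv:2111.08304 — 2 statements merged into one kernel-verified Lean document; each statement's English description precedes it below -/
import Mathlib

section
/- The function g(λ) = λ·K(√(1-λ²))/K(λ) satisfies g''(λ) = -(π/2)·((3-λ²)K(λ) - 2E(λ)) / (λ(1-λ²)²K(λ)³) < 0 for all λ ∈ (0,1); in particular g is strictly concave on (0,1). -/
/-- Complete elliptic integral of the first kind. -/
noncomputable def ellipticK (l : ℝ) : ℝ :=
  ∫ t in (0:ℝ)..1, 1 / Real.sqrt ((1 - t ^ 2) * (1 - l ^ 2 * t ^ 2))

/-- Complete elliptic integral of the second kind. -/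
noncomputable def ellipticE (l : ℝ) : ℝ :=
  ∫ t in (0:ℝ)..1, Real.sqrt ((1 - l ^ 2 * t ^ 2) / (1 - t ^ 2))

/-- `g(λ) = λ K(√(1-λ²))/K(λ)`. -/
noncomputable def gfun (l : ℝ) : ℝ :=
  l * ellipticK (Real.sqrt (1 - l ^ 2)) / ellipticK l

open Real Set MeasureTheory Filter Topology

noncomputable def ek (m : ℝ) : ℝ := ∫ x in (0:ℝ)..(π/2), 1 / √(1 - m * sin x ^ 2)
noncomputable def ee (m : ℝ) : ℝ := ∫ x in (0:ℝ)..(π/2), √(1 - m * sin x ^ 2)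

lemma image_sin : sin '' Ioo 0 (π/2) = Ioo 0 1 := by
  ext y
  constructor
  · rintro ⟨x, hx, rfl⟩
    refine ⟨sin_pos_of_pos_of_lt_pi hx.1 (by linarith [hx.2, pi_pos]), ?_⟩
    rw [← sin_pi_div_two]
    exact sin_lt_sin_of_lt_of_le_pi_div_two (by linarith [hx.1, pi_pos]) le_rfl hx.2
  · intro hy
    refine ⟨arcsin y, ⟨arcsin_pos.2 hy.1, arcsin_lt_pi_div_two.2 hy.2⟩,
      sin_arcsin (by linarith [hy.1]) hy.2.le⟩

lemma subst_sin (f : ℝ → ℝ) :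
    ∫ t in (0:ℝ)..1, f t = ∫ x in (0:ℝ)..(π/2), cos x * f (sin x) := by
  have hpi := pi_pos
  rw [intervalIntegral.integral_of_le zero_le_one,
    intervalIntegral.integral_of_le (by positivity), integral_Ioc_eq_integral_Ioo,
    integral_Ioc_eq_integral_Ioo, ← image_sin,
    integral_image_eq_integral_abs_deriv_smul measurableSet_Ioo
      (fun x _ => (hasDerivAt_sin x).hasDerivWithinAt)]
  · refine setIntegral_congr_fun measurableSet_Ioo fun x hx => ?_
    have : 0 < cos x := cos_pos_of_mem_Ioo ⟨by linarith [hx.1], hx.2⟩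
    simp [abs_of_pos this]
  · refine injOn_sin.mono fun x hx => ?_
    exact ⟨by linarith [hx.1], hx.2.le⟩

lemma ellipticK_eq (l : ℝ) : ellipticK l = ek (l^2) := by
  unfold ellipticK ek
  rw [subst_sin]
  have hpi := pi_pos
  rw [intervalIntegral.integral_of_le (by positivity),
    intervalIntegral.integral_of_le (by positivity), integral_Ioc_eq_integral_Ioo,
    integral_Ioc_eq_integral_Ioo]
  refine setIntegral_congr_fun measurableSet_Ioo fun x hx => ?_
  have hc : 0 < cos x := cos_pos_of_mem_Ioo ⟨by linarith [hx.1], hx.2⟩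
  have : 1 - sin x ^ 2 = cos x ^ 2 := by linarith [sin_sq_add_cos_sq x]
  simp only [this]
  rw [sqrt_mul (by positivity), sqrt_sq hc.le, one_div, mul_inv, ← mul_assoc,
    mul_inv_cancel₀ hc.ne', one_mul, one_div]

lemma ellipticE_eq (l : ℝ) : ellipticE l = ee (l^2) := by
  unfold ellipticE ee
  rw [subst_sin]
  have hpi := pi_pos
  rw [intervalIntegral.integral_of_le (by positivity),
    intervalIntegral.integral_of_le (by positivity), integral_Ioc_eq_integral_Ioo,
    integral_Ioc_eq_integral_Ioo]
  refine setIntegral_congr_fun measurableSet_Ioo fun x hx => ?_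
  have hc : 0 < cos x := cos_pos_of_mem_Ioo ⟨by linarith [hx.1], hx.2⟩
  have : 1 - sin x ^ 2 = cos x ^ 2 := by linarith [sin_sq_add_cos_sq x]
  simp only [this]
  rw [sqrt_div' _ (by positivity), sqrt_sq hc.le, mul_div_cancel₀ _ hc.ne']

lemma w_pos {m : ℝ} (h0 : 0 ≤ m) (h1 : m < 1) (x : ℝ) : 0 < 1 - m * sin x ^ 2 := by
  nlinarith [sin_sq_le_one x]

lemma w_ge {m : ℝ} (h0 : 0 ≤ m) (x : ℝ) : 1 - m ≤ 1 - m * sin x ^ 2 := by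
  nlinarith [sin_sq_le_one x]

lemma cont_e (m : ℝ) : Continuous fun x => √(1 - m * sin x ^ 2) := by fun_prop

lemma cont_k {m : ℝ} (h0 : 0 ≤ m) (h1 : m < 1) : Continuous fun x => 1 / √(1 - m * sin x ^ 2) :=
  continuous_const.div (cont_e m) fun x => (sqrt_pos.2 (w_pos h0 h1 x)).ne'

lemma cont_k3 {m : ℝ} (h0 : 0 ≤ m) (h1 : m < 1) :
    Continuous fun x => 1 / ((1 - m * sin x ^ 2) * √(1 - m * sin x ^ 2)) :=
  continuous_const.div ((by fun_prop : Continuous fun x => 1 - m * sin x ^ 2).mul (cont_e m))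
    fun x => (mul_pos (w_pos h0 h1 x) (sqrt_pos.2 (w_pos h0 h1 x))).ne'

lemma int_k3 {m : ℝ} (h0 : 0 < m) (h1 : m < 1) :
    (1 - m) * ∫ x in (0:ℝ)..(π/2), 1 / ((1 - m * sin x ^ 2) * √(1 - m * sin x ^ 2)) = ee m := by
  have hd : ∀ x : ℝ, HasDerivAt (fun x => m * (sin x * cos x / √(1 - m * sin x ^ 2)))
      (√(1 - m * sin x ^ 2) -
        (1 - m) * (1 / ((1 - m * sin x ^ 2) * √(1 - m * sin x ^ 2)))) x := by
    intro x
    have hw := w_pos h0.le h1 x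
    have hs := sqrt_pos.2 hw
    have h1 : HasDerivAt (fun x => 1 - m * sin x ^ 2) (-(m * (2 * sin x * cos x))) x := by
      have := (((hasDerivAt_sin x).pow 2).const_mul m).const_sub 1
      simpa using this
    have h2 := (((hasDerivAt_sin x).mul (hasDerivAt_cos x)).div (h1.sqrt hw.ne') hs.ne').const_mul m
    refine h2.congr_deriv ?_
    have hq : √(1 - m * sin x ^ 2) ^ 2 = 1 - m * sin x ^ 2 := sq_sqrt hw.le
    have hc : cos x ^ 2 = 1 - sin x ^ 2 := by linarith [sin_sq_add_cos_sq x]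
    simp only [Pi.mul_apply]
    generalize √(1 - m * sin x ^ 2) = q at *
    rw [← hq]
    field_simp
    have : m * sin x ^ 2 = 1 - q^2 := by linarith
    ring_nf
    have h4 : q^4 = (1 - m * sin x ^ 2)^2 := by rw [← hq]; ring
    simp only [hc, h4, hq]
    ring
  have hi := intervalIntegral.integral_eq_sub_of_hasDerivAt (a := 0) (b := π/2) (fun x _ => hd x)
    (((cont_e m).sub (continuous_const.mul (cont_k3 h0.le h1))).intervalIntegrable _ _)
  rw [intervalIntegral.integral_sub ((cont_e m).intervalIntegrable _ _)
    (((cont_k3 h0.le h1).intervalIntegrable _ _).const_mul _),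
    intervalIntegral.integral_const_mul] at hi
  simp at hi
  unfold ee
  simp
  linarith

lemma hasDerivAt_ee {m : ℝ} (h0 : 0 < m) (h1 : m < 1) :
    HasDerivAt ee ((ee m - ek m) / (2 * m)) m := by
  have key := (intervalIntegral.hasDerivAt_integral_of_dominated_loc_of_deriv_le (μ := volume)
    (a := 0) (b := π/2)
    (F := fun m x => √(1 - m * sin x ^ 2)) (F' := fun m x => - sin x ^ 2 / (2 * √(1 - m * sin x ^ 2)))
    (x₀ := m) (s := Ioo 0 ((m+1)/2)) (bound := fun _ => 1 / (2 * √(1 - (m+1)/2)))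
    (Ioo_mem_nhds h0 (by linarith)) (Eventually.of_forall fun y => (cont_e y).aestronglyMeasurable)
    ((cont_e m).intervalIntegrable _ _) ?_ ?_ (by simp) ?_).2
  · refine key.congr_deriv ?_
    unfold ee ek
    rw [← intervalIntegral.integral_sub ((cont_e m).intervalIntegrable _ _)
      ((cont_k h0.le h1).intervalIntegrable _ _), ← intervalIntegral.integral_div]
    congr 1
    ext x
    have hw := w_pos h0.le h1 x
    have hs := sqrt_pos.2 hw
    have hq : √(1 - m * sin x ^ 2) ^ 2 = 1 - m * sin x ^ 2 := sq_sqrt hw.le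
    generalize √(1 - m * sin x ^ 2) = q at *
    field_simp
    linarith
  · refine Continuous.aestronglyMeasurable ?_
    exact (by fun_prop : Continuous fun x => - sin x ^ 2).div (continuous_const.mul (cont_e m))
      fun x => (mul_pos two_pos (sqrt_pos.2 (w_pos h0.le h1 x))).ne'
  · refine Eventually.of_forall fun x _ y hy => ?_
    have hw := w_pos hy.1.le (by linarith [hy.2]) x
    have hs := sqrt_pos.2 hw
    rw [norm_div, norm_neg, norm_pow, norm_eq_abs, norm_eq_abs, abs_of_pos (by positivity : (0:ℝ) < 2 * √(1 - y * sin x ^ 2)), sq_abs]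
    have : √(1 - (m+1)/2) ≤ √(1 - y * sin x ^ 2) :=
      sqrt_le_sqrt (by linarith [w_ge hy.1.le x, hy.2])
    have h3 : 0 < √(1 - (m+1)/2) := sqrt_pos.2 (by linarith)
    have := sin_sq_le_one x
    gcongr
  · refine Eventually.of_forall fun x _ y hy => ?_
    have hw := w_pos hy.1.le (by linarith [hy.2]) x
    have := (((hasDerivAt_id y).mul_const (sin x ^ 2)).const_sub 1).sqrt hw.ne'
    simpa using this

lemma hasDerivAt_ek {m : ℝ} (h0 : 0 < m) (h1 : m < 1) :
    HasDerivAt ek ((ee m - (1 - m) * ek m) / (2 * m * (1 - m))) m := by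
  have key := (intervalIntegral.hasDerivAt_integral_of_dominated_loc_of_deriv_le (μ := volume)
    (a := 0) (b := π/2)
    (F := fun m x => 1 / √(1 - m * sin x ^ 2))
    (F' := fun m x => sin x ^ 2 / (2 * ((1 - m * sin x ^ 2) * √(1 - m * sin x ^ 2))))
    (x₀ := m) (s := Ioo 0 ((m+1)/2))
    (bound := fun _ => 1 / (2 * ((1 - (m+1)/2) * √(1 - (m+1)/2))))
    (Ioo_mem_nhds h0 (by linarith)) ?_
    ((cont_k h0.le h1).intervalIntegrable _ _) ?_ ?_ (by simp) ?_).2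
  · refine key.congr_deriv ?_
    rw [← int_k3 h0 h1]
    have h1m : 1 - m ≠ 0 := by linarith
    rw [← mul_sub, mul_comm (2 * m), mul_div_mul_left _ _ h1m]
    unfold ek
    rw [← intervalIntegral.integral_sub ((cont_k3 h0.le h1).intervalIntegrable _ _)
      ((cont_k h0.le h1).intervalIntegrable _ _), ← intervalIntegral.integral_div]
    congr 1
    ext x
    have hw := w_pos h0.le h1 x
    have hs := sqrt_pos.2 hw
    generalize √(1 - m * sin x ^ 2) = q at *
    have hw2 : sin x ^ 2 = (1 - (1 - m * sin x ^ 2)) / m := by field_simp; ring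
    generalize 1 - m * sin x ^ 2 = w at *
    rw [hw2]
    field_simp
  · filter_upwards [Ioo_mem_nhds h0 h1] with y hy
    exact (cont_k hy.1.le hy.2).aestronglyMeasurable
  · refine Continuous.aestronglyMeasurable ?_
    have := ((by fun_prop : Continuous fun x => sin x ^ 2).mul (cont_k3 h0.le h1)).div_const 2
    refine this.congr fun x => ?_
    simp only [Pi.mul_apply]
    rw [mul_one_div, div_div, mul_comm 2]
  · refine Eventually.of_forall fun x _ y hy => ?_
    have hw := w_pos hy.1.le (by linarith [hy.2]) x
    have hs := sqrt_pos.2 hw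
    rw [norm_of_nonneg (by positivity)]
    have h2 : (1 - (m+1)/2) ≤ (1 - y * sin x ^ 2) := (by linarith [w_ge hy.1.le x, hy.2])
    have : √(1 - (m+1)/2) ≤ √(1 - y * sin x ^ 2) := sqrt_le_sqrt h2
    have h4 : 0 < (1 - (m+1)/2) := by linarith
    have h3 : 0 < √(1 - (m+1)/2) := sqrt_pos.2 h4
    have := sin_sq_le_one x
    gcongr
  · refine Eventually.of_forall fun x _ y hy => ?_
    have hw := w_pos hy.1.le (by linarith [hy.2]) x
    have hs := sqrt_pos.2 hw
    have hq : √(1 - y * sin x ^ 2) ^ 2 = 1 - y * sin x ^ 2 := sq_sqrt hw.le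
    have := ((((hasDerivAt_id y).mul_const (sin x ^ 2)).const_sub 1).sqrt hw.ne').inv hs.ne'
    simp only [one_div]
    refine this.congr_deriv ?_
    simp only [id]
    rw [hq]
    generalize √(1 - y * sin x ^ 2) = q at *
    field_simp

lemma ek_ge {m : ℝ} (h0 : 0 ≤ m) (h1 : m < 1) : π / 2 ≤ ek m := by
  have := intervalIntegral.integral_mono_on (a := 0) (b := π/2) (by positivity)
    (intervalIntegrable_const (c := (1:ℝ))) ((cont_k h0 h1).intervalIntegrable (μ := volume) _ _)
    (fun x _ => by
      have hs := sqrt_pos.2 (w_pos h0 h1 x)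
      rw [le_div_iff₀ hs, one_mul]
      exact sqrt_le_one.2 (by nlinarith [sq_nonneg (sin x)]))
  simpa [ek] using this

lemma ek_le {m : ℝ} (h0 : 0 ≤ m) (h1 : m < 1) : ek m ≤ π / 2 / √(1 - m) := by
  have := intervalIntegral.integral_mono_on (a := 0) (b := π/2) (by positivity)
    ((cont_k h0 h1).intervalIntegrable (μ := volume) _ _)
    (intervalIntegrable_const (c := 1 / √(1 - m)))
    (fun x _ => by
      have hs := sqrt_pos.2 (w_pos h0 h1 x)
      have h2 : 0 < √(1 - m) := sqrt_pos.2 (by linarith)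
      have := sqrt_le_sqrt (w_ge h0 x)
      gcongr)
  simpa [ek, div_eq_mul_inv] using this

lemma ek_sub_ee_le {m : ℝ} (h0 : 0 ≤ m) (h1 : m < 1) : ek m - ee m ≤ m * ek m := by
  unfold ek ee
  rw [← intervalIntegral.integral_sub ((cont_k h0 h1).intervalIntegrable _ _)
    ((cont_e m).intervalIntegrable _ _), ← intervalIntegral.integral_const_mul]
  refine intervalIntegral.integral_mono_on (by positivity)
    (((cont_k h0 h1).sub (cont_e m)).intervalIntegrable _ _)
    (((cont_k h0 h1).intervalIntegrable _ _).const_mul _) fun x _ => ?_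
  have hw := w_pos h0 h1 x
  have hs := sqrt_pos.2 hw
  have hq : √(1 - m * sin x ^ 2) ^ 2 = 1 - m * sin x ^ 2 := sq_sqrt hw.le
  generalize √(1 - m * sin x ^ 2) = q at *
  have : 1 / q - q = (1 - q^2) / q := by field_simp
  rw [this, mul_one_div]
  gcongr
  nlinarith [sin_sq_le_one x]

lemma ee_le_ek {m : ℝ} (h0 : 0 ≤ m) (h1 : m < 1) : ee m ≤ ek m := by
  refine intervalIntegral.integral_mono_on (by positivity)
    ((cont_e m).intervalIntegrable _ _)
    ((cont_k h0 h1).intervalIntegrable _ _) fun x _ => ?_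
  have hw := w_pos h0 h1 x
  have hs := sqrt_pos.2 hw
  have hq : √(1 - m * sin x ^ 2) ^ 2 = 1 - m * sin x ^ 2 := sq_sqrt hw.le
  rw [le_div_iff₀ hs]
  nlinarith [mul_nonneg h0 (sq_nonneg (sin x))]

lemma ee_ge {m : ℝ} (h0 : 0 ≤ m) : 1 ≤ ee (1 - m) := by
  have := intervalIntegral.integral_mono_on (a := 0) (b := π/2) (by positivity)
    (continuous_cos.intervalIntegrable _ _)
    ((cont_e (1 - m)).intervalIntegrable (μ := volume) _ _)
    (fun x _ => by
      refine le_sqrt_of_sq_le ?_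
      nlinarith [sin_sq_add_cos_sq x, mul_nonneg h0 (sq_nonneg (sin x))])
  simpa [ee] using this

lemma ee_le {m : ℝ} (h0 : 0 ≤ m) : ee (1 - m) ≤ 1 + √m := by
  have := intervalIntegral.integral_mono_on (a := 0) (b := π/2) (by positivity)
    ((cont_e (1 - m)).intervalIntegrable (μ := volume) _ _)
    ((continuous_cos.add (continuous_const.mul continuous_sin :
      Continuous fun x => √m * sin x)).intervalIntegrable _ _)
    (fun x hx => by
      have hc := cos_nonneg_of_mem_Icc (x := x) ⟨by linarith [hx.1, pi_pos], hx.2⟩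
      have hs := sin_nonneg_of_nonneg_of_le_pi hx.1 (by linarith [hx.2, pi_pos])
      have hm := sqrt_nonneg m
      change _ ≤ cos x + √m * sin x
      refine sqrt_le_iff.2 ⟨by positivity, ?_⟩
      have := sq_sqrt h0
      have h3 := mul_nonneg hc (mul_nonneg hm hs)
      have h4 : (√m * sin x)^2 = m * sin x ^ 2 := by rw [mul_pow, this]
      nlinarith [sin_sq_add_cos_sq x])
  have h2 : ∫ x in (0:ℝ)..(π/2), (cos x + √m * sin x) = 1 + √m := by
    rw [intervalIntegral.integral_add (continuous_cos.intervalIntegrable _ _)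
      ((continuous_sin.intervalIntegrable _ _).const_mul _), intervalIntegral.integral_const_mul]
    simp
  exact this.trans h2.le

noncomputable def leg (m : ℝ) : ℝ := ee m * ek (1 - m) + ee (1 - m) * ek m - ek m * ek (1 - m)

lemma hasDerivAt_ek' {m : ℝ} (h0 : 0 < m) (h1 : m < 1) :
    HasDerivAt (fun m => ek (1 - m)) (-((ee (1 - m) - m * ek (1 - m)) / (2 * (1 - m) * m))) m := by
  have := (hasDerivAt_ek (m := 1 - m) (by linarith) (by linarith)).comp m
    ((hasDerivAt_id m).const_sub 1)
  simpa [Function.comp_def] using this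

lemma hasDerivAt_ee' {m : ℝ} (h0 : 0 < m) (h1 : m < 1) :
    HasDerivAt (fun m => ee (1 - m)) (-((ee (1 - m) - ek (1 - m)) / (2 * (1 - m)))) m := by
  have := (hasDerivAt_ee (m := 1 - m) (by linarith) (by linarith)).comp m
    ((hasDerivAt_id m).const_sub 1)
  simpa [Function.comp_def] using this

lemma hasDerivAt_leg {m : ℝ} (h0 : 0 < m) (h1 : m < 1) : HasDerivAt leg 0 m := by
  have := (((hasDerivAt_ee h0 h1).mul (hasDerivAt_ek' h0 h1)).add
    ((hasDerivAt_ee' h0 h1).mul (hasDerivAt_ek h0 h1))).sub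
    ((hasDerivAt_ek h0 h1).mul (hasDerivAt_ek' h0 h1))
  refine this.congr_deriv ?_
  have h3 : 1 - m ≠ 0 := by linarith
  field_simp
  ring

lemma leg_tendsto : Tendsto leg (𝓝[>] 0) (𝓝 (π / 2)) := by
  have hm : Ioo (0:ℝ) 1 ∈ 𝓝[>] (0:ℝ) := Ioo_mem_nhdsGT one_pos
  have c1 : ContinuousAt (fun m : ℝ => π / 2 - √m * (π / 2) ^ 2 / √(1 - m)) 0 := by
    refine ContinuousAt.sub (by fun_prop) (ContinuousAt.div (by fun_prop) (by fun_prop) (by simp))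
  have c2 : ContinuousAt (fun m : ℝ => (1 + √m) * (π / 2 / √(1 - m))) 0 := by
    refine ContinuousAt.mul (by fun_prop) (ContinuousAt.div (by fun_prop) (by fun_prop) (by simp))
  have t1 := c1.tendsto.mono_left (nhdsWithin_le_nhds (s := Ioi 0))
  have t2 := c2.tendsto.mono_left (nhdsWithin_le_nhds (s := Ioi 0))
  simp only [sqrt_zero, zero_mul, sub_zero, sqrt_one, div_one, add_zero, one_mul] at t1 t2
  refine tendsto_of_tendsto_of_tendsto_of_le_of_le' t1 t2 ?_ ?_
  all_goals
    filter_upwards [hm] with m ⟨h0, h1⟩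
    have hpi := pi_pos
    have a1 := ek_ge h0.le h1
    have a2 := ek_le h0.le h1
    have a3 := ek_sub_ee_le h0.le h1
    have a4 := ee_le_ek h0.le h1
    have a5 := ee_ge h0.le
    have a6 := ee_le h0.le
    have a7 := ek_ge (m := 1 - m) (by linarith) (by linarith)
    have a8 := ek_le (m := 1 - m) (by linarith) (by linarith)
    have hs := sqrt_pos.2 h0
    have hs1 : 0 < √(1 - m) := sqrt_pos.2 (by linarith)
    rw [sub_sub_cancel] at a8
    unfold leg
  · have b1 : (ek m - ee m) * ek (1 - m) ≤ (m * (π / 2 / √(1 - m))) * (π / 2 / √m) := by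
      refine mul_le_mul (a3.trans ?_) a8 (by linarith) (by positivity)
      gcongr
    have b2 : (m * (π / 2 / √(1 - m))) * (π / 2 / √m) = √m * (π / 2) ^ 2 / √(1 - m) := by
      have := sq_sqrt h0.le
      generalize √m = q at *
      subst this
      field_simp
    have b3 : 1 * (π / 2) ≤ ee (1 - m) * ek m := by gcongr
    nlinarith
  · have b1 : 0 ≤ (ek m - ee m) * ek (1 - m) := mul_nonneg (by linarith) (by linarith)
    have b3 : ee (1 - m) * ek m ≤ (1 + √m) * (π / 2 / √(1 - m)) :=
      mul_le_mul a6 a2 (by linarith) (by positivity)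
    nlinarith

lemma leg_eq {m : ℝ} (h0 : 0 < m) (h1 : m < 1) : leg m = π / 2 := by
  have h : ∀ x ∈ Ioo (0:ℝ) 1, leg x = leg m := fun x hx =>
    isOpen_Ioo.is_const_of_deriv_eq_zero (isPreconnected_Ioo)
      (fun y hy => (hasDerivAt_leg hy.1 hy.2).differentiableAt.differentiableWithinAt)
      (fun y hy => (hasDerivAt_leg hy.1 hy.2).deriv) hx ⟨h0, h1⟩
  have h2 : Tendsto leg (𝓝[>] 0) (𝓝 (leg m)) := by
    refine tendsto_const_nhds.congr' ?_
    filter_upwards [Ioo_mem_nhdsGT one_pos] with x hx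
    exact (h x hx).symm
  exact tendsto_nhds_unique h2 leg_tendsto

lemma ek_pos {m : ℝ} (h0 : 0 ≤ m) (h1 : m < 1) : 0 < ek m :=
  lt_of_lt_of_le (by positivity) (ek_ge h0 h1)

lemma hasDerivAt_h {m : ℝ} (h0 : 0 < m) (h1 : m < 1) :
    HasDerivAt (fun m => ek (1 - m) / ek m) (-(π / 2) / (2 * m * (1 - m) * ek m ^ 2)) m := by
  have hk := ek_pos h0.le h1
  refine ((hasDerivAt_ek' h0 h1).div (hasDerivAt_ek h0 h1) hk.ne').congr_deriv ?_
  rw [← leg_eq h0 h1]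
  have h3 : 1 - m ≠ 0 := by linarith
  unfold leg
  field_simp
  ring

lemma sq_mem {l : ℝ} (hl : l ∈ Ioo (0:ℝ) 1) : 0 < l ^ 2 ∧ l ^ 2 < 1 :=
  ⟨by have := hl.1; positivity, by nlinarith [hl.1, hl.2]⟩

lemma gfun_eq {l : ℝ} (hl : l ∈ Ioo (0:ℝ) 1) : gfun l = l * (ek (1 - l ^ 2) / ek (l ^ 2)) := by
  unfold gfun
  rw [ellipticK_eq, ellipticK_eq, sq_sqrt (by linarith [(sq_mem hl).2]), mul_div_assoc]

lemma hasDerivAt_gfun {l : ℝ} (hl : l ∈ Ioo (0:ℝ) 1) :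
    HasDerivAt gfun (ek (1 - l ^ 2) / ek (l ^ 2) - (π / 2) / ((1 - l ^ 2) * ek (l ^ 2) ^ 2)) l := by
  have hm := sq_mem hl
  have hk := ek_pos hm.1.le hm.2
  have h1 := (hasDerivAt_id l).mul
    (HasDerivAt.comp (h := fun x : ℝ => x ^ 2) l (hasDerivAt_h hm.1 hm.2) (hasDerivAt_pow 2 l))
  have h2 : HasDerivAt gfun _ l := h1.congr_of_eventuallyEq (by
    filter_upwards [isOpen_Ioo.mem_nhds hl] with x hx
    exact gfun_eq hx)
  refine h2.congr_deriv ?_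
  have h3 : 1 - l ^ 2 ≠ 0 := by linarith
  have h4 := hl.1.ne'
  simp
  field_simp
  ring

lemma hasDerivAt_gfun' {l : ℝ} (hl : l ∈ Ioo (0:ℝ) 1) :
    HasDerivAt (deriv gfun) (-(π / 2) * ((3 - l ^ 2) * ek (l ^ 2) - 2 * ee (l ^ 2)) /
          (l * (1 - l ^ 2) ^ 2 * ek (l ^ 2) ^ 3)) l := by
  have hm := sq_mem hl
  have hk := ek_pos hm.1.le hm.2
  have h3 : 1 - l ^ 2 ≠ 0 := by linarith
  have h4 := hl.1.ne'
  have d1 := HasDerivAt.comp (h := fun x : ℝ => x ^ 2) l (hasDerivAt_h hm.1 hm.2) (hasDerivAt_pow 2 l)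
  have d2 := HasDerivAt.comp (h := fun x : ℝ => x ^ 2) l (hasDerivAt_ek hm.1 hm.2) (hasDerivAt_pow 2 l)
  have d3 := ((hasDerivAt_pow 2 l).const_sub 1).mul (d2.pow 2)
  have d4 := d1.sub ((hasDerivAt_const l (π / 2)).div d3 (by simp; exact ⟨h3, hk.ne'⟩))
  have h2 : HasDerivAt (deriv gfun) _ l := d4.congr_of_eventuallyEq (by
    filter_upwards [isOpen_Ioo.mem_nhds hl] with x hx
    exact (hasDerivAt_gfun hx).deriv)
  refine h2.congr_deriv ?_
  simp
  field_simp
  ring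

theorem g_second_deriv_neg :
    (∀ l ∈ Set.Ioo (0:ℝ) 1,
      deriv (deriv gfun) l =
        -(Real.pi / 2) * ((3 - l ^ 2) * ellipticK l - 2 * ellipticE l) /
          (l * (1 - l ^ 2) ^ 2 * ellipticK l ^ 3) ∧
      deriv (deriv gfun) l < 0) ∧
    StrictConcaveOn ℝ (Set.Ioo (0:ℝ) 1) gfun := by
  have hneg : ∀ l ∈ Set.Ioo (0:ℝ) 1, deriv (deriv gfun) l < 0 := by
    intro l hl
    have hm := sq_mem hl
    have hk := ek_pos hm.1.le hm.2
    have he := ee_le_ek hm.1.le hm.2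
    have h3 : 0 < 1 - l ^ 2 := by linarith
    have h4 := hl.1
    rw [(hasDerivAt_gfun' hl).deriv, neg_mul, neg_div, neg_lt_zero]
    have : 0 < (3 - l ^ 2) * ek (l ^ 2) - 2 * ee (l ^ 2) := by nlinarith [mul_pos h3 hk]
    positivity
  refine ⟨fun l hl => ⟨?_, hneg l hl⟩, ?_⟩
  · rw [(hasDerivAt_gfun' hl).deriv, ellipticK_eq, ellipticE_eq]
  · refine strictConcaveOn_of_deriv2_neg' (convex_Ioo 0 1)
      (fun l hl => (hasDerivAt_gfun hl).continuousAt.continuousWithinAt) hneg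
end

section
/- There exists a unique λ₀ ∈ (0,1) such that (1-λ₀²)·K(λ₀)·K(√(1-λ₀²)) = π/2, and the function g(λ) = λK(√(1-λ²))/K(λ) attains its maximum on (0,1) exactly at λ₀. -/
open Set Filter Topology MeasureTheory

namespace EllAux

lemma delta_pos {m : ℝ} (hm : m < 1) (t : ℝ) : 0 < 1 - m * Real.sin t ^ 2 := by
  have h1 := Real.sin_sq_le_one t
  have h2 := sq_nonneg (Real.sin t)
  rcases le_or_gt m 0 with h | h
  · nlinarith [mul_nonneg (neg_nonneg.mpr h) h2]
  · nlinarith [mul_le_mul_of_nonneg_left h1 h.le]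

noncomputable def U (m t : ℝ) : ℝ := (Real.sqrt (1 - m * Real.sin t ^ 2))⁻¹

lemma U_pos {m : ℝ} (hm : m < 1) (t : ℝ) : 0 < U m t :=
  inv_pos.mpr (Real.sqrt_pos.mpr (delta_pos hm t))

lemma U_sq {m : ℝ} (hm : m < 1) (t : ℝ) : U m t ^ 2 * (1 - m * Real.sin t ^ 2) = 1 := by
  have h := delta_pos hm t
  unfold U
  rw [inv_pow, Real.sq_sqrt h.le]
  exact inv_mul_cancel₀ h.ne'

lemma U_deriv_aux {f : ℝ → ℝ} {f' x : ℝ} (hf : HasDerivAt f f' x) (hpos : 0 < f x) :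
    HasDerivAt (fun y => (Real.sqrt (f y))⁻¹) (-(f' / 2) * ((Real.sqrt (f x))⁻¹) ^ 3) x := by
  have hs : 0 < Real.sqrt (f x) := Real.sqrt_pos.mpr hpos
  refine ((hf.sqrt hpos.ne').inv hs.ne').congr_deriv ?_
  field_simp

lemma U_deriv_m {m : ℝ} (hm : m < 1) (t : ℝ) :
    HasDerivAt (fun m => U m t) (Real.sin t ^ 2 / 2 * U m t ^ 3) m := by
  have h : HasDerivAt (fun m : ℝ => 1 - m * Real.sin t ^ 2) (-(Real.sin t ^ 2)) m := by
    simpa using ((hasDerivAt_id m).mul_const (Real.sin t ^ 2)).const_sub 1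
  refine (U_deriv_aux h (delta_pos hm t)).congr_deriv ?_
  simp only [U]; ring

lemma U_deriv_t {m : ℝ} (hm : m < 1) (t : ℝ) :
    HasDerivAt (fun t => U m t) (m * Real.sin t * Real.cos t * U m t ^ 3) t := by
  have h : HasDerivAt (fun t : ℝ => 1 - m * Real.sin t ^ 2)
      (-(m * (2 * Real.sin t * Real.cos t))) t := by
    simpa using (((Real.hasDerivAt_sin t).pow 2).const_mul m).const_sub 1
  refine (U_deriv_aux h (delta_pos hm t)).congr_deriv ?_
  simp only [U]; ring

lemma U_contOn : ContinuousOn (fun p : ℝ × ℝ => U p.1 p.2) (Iio 1 ×ˢ univ) := by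
  unfold U
  apply ContinuousOn.inv₀
  · fun_prop
  · rintro ⟨m, t⟩ ⟨hm, -⟩
    exact (Real.sqrt_pos.mpr (delta_pos hm t)).ne'

lemma U_cont {m : ℝ} (hm : m < 1) : Continuous (U m) :=
  continuous_iff_continuousAt.mpr fun t => (U_deriv_t hm t).continuousAt

lemma deriv_int {F F' : ℝ → ℝ → ℝ} (hF : ∀ m < 1, Continuous (F m))
    (hF' : ContinuousOn (fun p : ℝ × ℝ => F' p.1 p.2) (Iio 1 ×ˢ univ))
    (hd : ∀ m < 1, ∀ t, HasDerivAt (fun m => F m t) (F' m t) m) {m : ℝ} (hm : m < 1) :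
    HasDerivAt (fun m => ∫ t in (0:ℝ)..(Real.pi / 2), F m t)
      (∫ t in (0:ℝ)..(Real.pi / 2), F' m t) m := by
  set b := (m + 1) / 2 with hb
  have hb1 : b < 1 := by rw [hb]; linarith
  have hmb : m < b := by rw [hb]; linarith
  have hK : IsCompact (Icc (m - 1) b ×ˢ uIcc (0:ℝ) (Real.pi / 2)) := isCompact_Icc.prod isCompact_uIcc
  obtain ⟨C, hC⟩ := hK.exists_bound_of_continuousOn (hF'.mono (by
    rintro ⟨x, y⟩ ⟨hx, -⟩
    exact ⟨lt_of_le_of_lt hx.2 hb1, trivial⟩))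
  have hc : Continuous (F' m) := by
    have : ContinuousOn (F' m) univ :=
      hF'.comp (f := fun t => (m, t)) (by fun_prop) (fun t _ => ⟨hm, trivial⟩)
    exact continuousOn_univ.mp this
  refine (intervalIntegral.hasDerivAt_integral_of_dominated_loc_of_deriv_le (s := Icc (m-1) b)
    (F := F) (F' := F') (bound := fun _ => C)
    (Icc_mem_nhds (by linarith) hmb) ?_ ((hF m hm).intervalIntegrable _ _)
    hc.aestronglyMeasurable ?_ (by simp) ?_).2
  · filter_upwards [Iio_mem_nhds hm] with x hx
    exact (hF x hx).aestronglyMeasurable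
  · refine Eventually.of_forall fun t ht x hx => ?_
    exact hC (x, t) ⟨hx, uIoc_subset_uIcc ht⟩
  · exact Eventually.of_forall fun t ht x hx => hd x (lt_of_le_of_lt hx.2 hb1) t

noncomputable def J (m : ℝ) : ℝ := ∫ t in (0:ℝ)..(Real.pi / 2), U m t
noncomputable def D (m : ℝ) : ℝ := ∫ t in (0:ℝ)..(Real.pi / 2), Real.sin t ^ 2 / 2 * U m t ^ 3

lemma J_deriv {m : ℝ} (hm : m < 1) : HasDerivAt J (D m) m := by
  refine deriv_int (F := U) (F' := fun m t => Real.sin t ^ 2 / 2 * U m t ^ 3)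
    (fun m h => U_cont h) ?_ (fun m h t => U_deriv_m h t) hm
  exact ContinuousOn.mul (by fun_prop) (U_contOn.pow 3)

lemma D_deriv {m : ℝ} (hm : m < 1) : HasDerivAt D
    (∫ t in (0:ℝ)..(Real.pi / 2), 3 / 4 * Real.sin t ^ 4 * U m t ^ 5) m := by
  refine deriv_int (F := fun m t => Real.sin t ^ 2 / 2 * U m t ^ 3)
    (F' := fun m t => 3 / 4 * Real.sin t ^ 4 * U m t ^ 5)
    (fun m h => ?_) ?_ (fun m h t => ?_) hm
  · have := U_cont h
    fun_prop
  · exact ContinuousOn.mul (by fun_prop) (U_contOn.pow 5)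
  · refine (((U_deriv_m h t).pow 3).const_mul (Real.sin t ^ 2 / 2)).congr_deriv ?_
    push_cast
    ring

lemma P_deriv {m : ℝ} (hm : m < 1) :
    HasDerivAt (fun m => m * (1 - m) * D m) (J m / 4) m := by
  have h1 : HasDerivAt (fun m : ℝ => m * (1 - m)) (1 - 2 * m) m := by
    refine ((hasDerivAt_id m).mul ((hasDerivAt_id m).const_sub 1)).congr_deriv ?_
    simp only [id]; ring
  refine (h1.mul (D_deriv hm)).congr_deriv ?_
  have hU := U_cont hm
  have hz : ∫ t in (0:ℝ)..(Real.pi / 2),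
      (1 - 2 * Real.sin t ^ 2 + 3 * m * Real.sin t ^ 2 * (1 - Real.sin t ^ 2) * U m t ^ 2)
        * U m t ^ 3 = 0 := by
    rw [intervalIntegral.integral_eq_sub_of_hasDerivAt
      (f := fun t => Real.sin t * Real.cos t * U m t ^ 3)]
    · simp
    · intro t _
      refine (((Real.hasDerivAt_sin t).mul (Real.hasDerivAt_cos t)).mul
        ((U_deriv_t hm t).pow 3)).congr_deriv ?_
      have hc : Real.cos t ^ 2 = 1 - Real.sin t ^ 2 := Real.cos_sq' t
      simp only [Pi.mul_apply, Pi.pow_apply]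
      push_cast
      linear_combination (U m t ^ 3 + 3 * m * Real.sin t ^ 2 * U m t ^ 5) * hc
    · apply Continuous.intervalIntegrable
      fun_prop
  have key : (1 - 2 * m) * D m + m * (1 - m) *
      (∫ t in (0:ℝ)..(Real.pi / 2), 3 / 4 * Real.sin t ^ 4 * U m t ^ 5) - J m / 4
      = (-1/4) * ∫ t in (0:ℝ)..(Real.pi / 2),
      (1 - 2 * Real.sin t ^ 2 + 3 * m * Real.sin t ^ 2 * (1 - Real.sin t ^ 2) * U m t ^ 2)
        * U m t ^ 3 := by
    unfold D J
    rw [← intervalIntegral.integral_const_mul, ← intervalIntegral.integral_const_mul,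
      ← intervalIntegral.integral_const_mul, ← intervalIntegral.integral_div,
      ← intervalIntegral.integral_add, ← intervalIntegral.integral_sub]
    · apply intervalIntegral.integral_congr
      intro t _
      have h := U_sq hm t
      simp only
      generalize Real.sin t = s at *
      generalize U m t = u at *
      have e1 : u = u ^ 5 * (1 - m * s ^ 2) ^ 2 := by
        linear_combination (-u ^ 3 * (1 - m * s ^ 2) - u) * h
      have e2 : u ^ 3 = u ^ 5 * (1 - m * s ^ 2) := by
        linear_combination (-u ^ 3) * h
      linear_combination (-1/4) * e1 + ((1 - 2 * m) * s ^ 2 / 2 + (1 - 2 * s ^ 2) / 4) * e2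
    all_goals
      apply Continuous.intervalIntegrable
      fun_prop
  rw [hz] at key
  linarith

lemma W_const {x y : ℝ} (hx : x ∈ Ioo (0:ℝ) 1) (hy : y ∈ Ioo (0:ℝ) 1) :
    x * (1 - x) * (D x * J (1 - x) + D (1 - x) * J x)
      = y * (1 - y) * (D y * J (1 - y) + D (1 - y) * J y) := by
  have hd : ∀ m ∈ Ioo (0:ℝ) 1, HasDerivAt
      (fun x => x * (1 - x) * (D x * J (1 - x) + D (1 - x) * J x)) 0 m := by
    intro m hm
    have h1 := P_deriv hm.2
    have h2 := J_deriv hm.2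
    have hm' : 1 - m < 1 := by linarith [hm.1]
    have hs : HasDerivAt (fun x : ℝ => 1 - x) (-1) m := by
      simpa using (hasDerivAt_id m).const_sub 1
    have h3 : HasDerivAt (fun x => (1 - x) * (1 - (1 - x)) * D (1 - x)) (J (1 - m) / 4 * -1) m :=
      HasDerivAt.comp (h₂ := fun m => m * (1 - m) * D m) (h := fun x => 1 - x) m (P_deriv hm') hs
    have h4 : HasDerivAt (fun x => J (1 - x)) (D (1 - m) * -1) m :=
      HasDerivAt.comp (h₂ := J) (h := fun x => 1 - x) m (J_deriv hm') hs
    have h5 : HasDerivAt (fun x => x * (1 - x) * D x * J (1 - x)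
        + (1 - x) * (1 - (1 - x)) * D (1 - x) * J x) 0 m := by
      refine ((h1.mul h4).add (h3.mul h2)).congr_deriv ?_
      ring
    have he : (fun x => x * (1 - x) * (D x * J (1 - x) + D (1 - x) * J x))
        = (fun x => x * (1 - x) * D x * J (1 - x)
        + (1 - x) * (1 - (1 - x)) * D (1 - x) * J x) := by
      ext x
      ring
    rw [he]
    exact h5
  exact isOpen_Ioo.is_const_of_deriv_eq_zero isPreconnected_Ioo
    (f := fun x => x * (1 - x) * (D x * J (1 - x) + D (1 - x) * J x))
    (fun m hm => (hd m hm).differentiableAt.differentiableWithinAt)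
    (fun m hm => (hd m hm).deriv) hx hy

lemma J_lower {m : ℝ} (hm0 : 0 ≤ m) (hm : m < 1) : Real.pi / 2 ≤ J m := by
  have h : ∫ t in (0:ℝ)..(Real.pi / 2), (1:ℝ) ≤ J m := by
    apply intervalIntegral.integral_mono_on (by positivity) (by simp)
      ((U_cont hm).intervalIntegrable _ _)
    intro t _
    unfold U
    apply (one_le_inv₀ (Real.sqrt_pos.mpr (delta_pos hm t))).mpr
    rw [Real.sqrt_le_one]
    nlinarith [sq_nonneg (Real.sin t)]
  simpa using h

lemma J_upper {m : ℝ} (hm0 : 0 ≤ m) (hm : m < 1) :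
    Real.sqrt (1 - m) * J m ≤ Real.pi / 2 := by
  have h : ∫ t in (0:ℝ)..(Real.pi / 2), Real.sqrt (1 - m) * U m t
      ≤ ∫ t in (0:ℝ)..(Real.pi / 2), (1:ℝ) := by
    apply intervalIntegral.integral_mono_on (by positivity) 
      ((continuous_const.mul (U_cont hm)).intervalIntegrable _ _) (by simp)
    intro t _
    change Real.sqrt (1 - m) * U m t ≤ 1
    unfold U
    rw [← div_eq_mul_inv, div_le_one (Real.sqrt_pos.mpr (delta_pos hm t))]
    apply Real.sqrt_le_sqrt
    nlinarith [Real.sin_sq_le_one t]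
  rw [intervalIntegral.integral_const_mul] at h
  simpa [J] using h

lemma D_pos {m : ℝ} (hm : m < 1) : 0 < D m := by
  have hU := U_cont hm
  apply intervalIntegral.intervalIntegral_pos_of_pos_on
  · apply Continuous.intervalIntegrable
    fun_prop
  · intro t ht
    have := U_pos hm t
    have := Real.sin_pos_of_pos_of_lt_pi ht.1 (by linarith [ht.2, Real.pi_pos])
    positivity
  · positivity

lemma sinInt {m : ℝ} (hm : 0 < m) :
    ∫ t in (0:ℝ)..(Real.pi / 2), m * Real.sin t * U (1 - m) t ^ 3 = 1 := by
  have hm' : 1 - m < 1 := by linarith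
  have hU := U_cont hm'
  rw [intervalIntegral.integral_eq_sub_of_hasDerivAt
      (f := fun t => - (Real.cos t * U (1 - m) t))]
  · simp [U]
  · intro t _
    refine ((Real.hasDerivAt_cos t).mul (U_deriv_t hm' t)).neg.congr_deriv ?_
    have hc : Real.cos t ^ 2 = 1 - Real.sin t ^ 2 := Real.cos_sq' t
    have h := U_sq hm' t
    linear_combination (-(1 - m) * Real.sin t * U (1 - m) t ^ 3) * hc
      - (Real.sin t * U (1 - m) t) * h
  · apply Continuous.intervalIntegrable
    fun_prop

lemma D_upper {m : ℝ} (hm : 0 < m) : 2 * (m * D (1 - m)) ≤ 1 := by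
  have hm' : 1 - m < 1 := by linarith
  have hU := U_cont hm'
  refine le_trans ?_ (sinInt hm).le
  rw [D, ← intervalIntegral.integral_const_mul, ← intervalIntegral.integral_const_mul]
  apply intervalIntegral.integral_mono_on (by positivity)
  · apply Continuous.intervalIntegrable
    fun_prop
  · apply Continuous.intervalIntegrable
    fun_prop
  · intro t ht
    have h1 := Real.sin_nonneg_of_nonneg_of_le_pi ht.1 (by linarith [ht.2, Real.pi_pos])
    have h2 := Real.sin_le_one t
    have h3 := U_pos hm' t
    have : Real.sin t ^ 2 ≤ Real.sin t := by nlinarith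
    calc _ = m * Real.sin t ^ 2 * U (1 - m) t ^ 3 := by ring
      _ ≤ _ := by gcongr

lemma D_lower {m : ℝ} (hm : 0 < m) : 1 - m * J (1 - m) ≤ 2 * (m * D (1 - m)) := by
  have hm' : 1 - m < 1 := by linarith
  have hU := U_cont hm'
  have hS : 1 - m * J (1 - m) = (∫ t in (0:ℝ)..(Real.pi / 2), m * Real.sin t * U (1 - m) t ^ 3)
      - m * J (1 - m) := by rw [sinInt hm]
  rw [hS, D, J, ← intervalIntegral.integral_const_mul,
    ← intervalIntegral.integral_const_mul, ← intervalIntegral.integral_const_mul,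
    ← intervalIntegral.integral_sub]
  · apply intervalIntegral.integral_mono_on (by positivity)
    · apply Continuous.intervalIntegrable
      fun_prop
    · apply Continuous.intervalIntegrable
      fun_prop
    · intro t ht
      have h2 := Real.sin_le_one t
      have h3 := U_pos hm' t
      have h := U_sq hm' t
      have e2 : U (1 - m) t = U (1 - m) t ^ 3 * (1 - (1 - m) * Real.sin t ^ 2) := by
        linear_combination (-U (1 - m) t) * h
      have : 0 ≤ m * U (1 - m) t ^ 3 *
          (1 - (1 - m) * Real.sin t ^ 2 + Real.sin t ^ 2 - Real.sin t) := by
        apply mul_nonneg (by positivity)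
        nlinarith [mul_nonneg hm.le (sq_nonneg (Real.sin t))]
      linear_combination m * (- e2) + this
  all_goals
    apply Continuous.intervalIntegrable
    fun_prop

lemma mJ_tendsto : Tendsto (fun m : ℝ => m * J (1 - m)) (𝓝[>] 0) (𝓝 0) := by
  have hu : Tendsto (fun m : ℝ => Real.sqrt m * (Real.pi / 2)) (𝓝[>] 0) (𝓝 0) := by
    have : Continuous (fun m : ℝ => Real.sqrt m * (Real.pi / 2)) := by fun_prop
    simpa using (this.tendsto 0).mono_left nhdsWithin_le_nhds
  refine tendsto_of_tendsto_of_tendsto_of_le_of_le' tendsto_const_nhds hu ?_ ?_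
  · filter_upwards [Ioo_mem_nhdsGT (zero_lt_one' ℝ)] with m hm
    have := J_lower (m := 1 - m) (by linarith [hm.2]) (by linarith [hm.1])
    have := Real.pi_pos
    exact mul_nonneg hm.1.le (by linarith)
  · filter_upwards [Ioo_mem_nhdsGT (zero_lt_one' ℝ)] with m hm
    have := J_upper (m := 1 - m) (by linarith [hm.2]) (by linarith [hm.1])
    rw [sub_sub_cancel] at this
    calc m * J (1 - m) = Real.sqrt m * (Real.sqrt m * J (1 - m)) := by
          rw [← mul_assoc, Real.mul_self_sqrt hm.1.le]
      _ ≤ _ := by gcongr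

lemma mD_tendsto : Tendsto (fun m : ℝ => 2 * (m * D (1 - m))) (𝓝[>] 0) (𝓝 1) := by
  have h : Tendsto (fun m : ℝ => 1 - m * J (1 - m)) (𝓝[>] 0) (𝓝 1) := by
    simpa using mJ_tendsto.const_sub 1
  refine tendsto_of_tendsto_of_tendsto_of_le_of_le' h tendsto_const_nhds ?_ ?_
  · filter_upwards [self_mem_nhdsWithin] with m hm using D_lower hm
  · filter_upwards [self_mem_nhdsWithin] with m hm using D_upper hm

lemma J_zero : J 0 = Real.pi / 2 := by simp [J, U]

lemma legendre {x : ℝ} (hx : x ∈ Ioo (0:ℝ) 1) :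
    x * (1 - x) * (D x * J (1 - x) + D (1 - x) * J x) = Real.pi / 4 := by
  have hJ : Tendsto J (𝓝[>] 0) (𝓝 (Real.pi / 2)) := by
    rw [← J_zero]
    exact (J_deriv zero_lt_one).continuousAt.tendsto.mono_left nhdsWithin_le_nhds
  have hD : Tendsto D (𝓝[>] 0) (𝓝 (D 0)) :=
    (D_deriv zero_lt_one).continuousAt.tendsto.mono_left nhdsWithin_le_nhds
  have h1 : Tendsto (fun m : ℝ => 1 - m) (𝓝[>] 0) (𝓝 1) := by
    have : Continuous (fun m : ℝ => 1 - m) := by fun_prop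
    simpa using (this.tendsto 0).mono_left nhdsWithin_le_nhds
  have hl := h1.mul ((mJ_tendsto.mul hD).add ((mD_tendsto.mul hJ).const_mul (1/2)))
  have hc : Tendsto (fun y => (1 - y) * (y * J (1 - y) * D y + 1 / 2 * (2 * (y * D (1 - y)) * J y)))
      (𝓝[>] 0) (𝓝 (x * (1 - x) * (D x * J (1 - x) + D (1 - x) * J x))) := by
    refine tendsto_const_nhds.congr' ?_
    filter_upwards [Ioo_mem_nhdsGT (zero_lt_one' ℝ)] with y hy
    rw [W_const hx hy]
    ring
  rw [tendsto_nhds_unique hc hl]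
  ring

lemma ellipticK_eq {l : ℝ} : ellipticK l = J (l ^ 2) := by
  have him : Real.sin '' Ioo 0 (Real.pi / 2) = Ioo 0 1 := by
    ext y
    constructor
    · rintro ⟨t, ht, rfl⟩
      refine ⟨Real.sin_pos_of_pos_of_lt_pi ht.1 (by linarith [ht.2, Real.pi_pos]), ?_⟩
      have := Real.sin_lt_sin_of_lt_of_le_pi_div_two (by linarith [ht.1, Real.pi_pos]) le_rfl ht.2
      simpa using this
    · intro hy
      exact ⟨Real.arcsin y, ⟨Real.arcsin_pos.mpr hy.1, Real.arcsin_lt_pi_div_two.mpr hy.2⟩,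
        Real.sin_arcsin (by linarith [hy.1]) hy.2.le⟩
  have hinj : InjOn Real.sin (Ioo 0 (Real.pi / 2)) :=
    Real.injOn_sin.mono (fun t (ht : t ∈ Ioo 0 (Real.pi / 2)) =>
      (⟨by linarith [ht.1, Real.pi_pos], ht.2.le⟩ : t ∈ Icc (-(Real.pi / 2)) (Real.pi / 2)))
  unfold ellipticK J
  rw [intervalIntegral.integral_of_le zero_le_one, intervalIntegral.integral_of_le (by positivity),
    integral_Ioc_eq_integral_Ioo, integral_Ioc_eq_integral_Ioo, ← him,
    integral_image_eq_integral_abs_deriv_smul measurableSet_Ioo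
      (fun t _ => (Real.hasDerivAt_sin t).hasDerivWithinAt) hinj]
  apply setIntegral_congr_fun measurableSet_Ioo
  intro t ht
  have hc : 0 < Real.cos t := Real.cos_pos_of_mem_Ioo ⟨by linarith [ht.1, Real.pi_pos], ht.2⟩
  simp only [smul_eq_mul, U]
  rw [← Real.cos_sq', Real.sqrt_mul (sq_nonneg _), Real.sqrt_sq hc.le, abs_of_pos hc]
  field_simp

lemma J_strictMono : StrictMonoOn J (Iio 1) := by
  apply strictMonoOn_of_deriv_pos (convex_Iio 1)
  · exact fun m hm => (J_deriv hm).continuousAt.continuousWithinAt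
  · intro m hm
    rw [interior_Iio] at hm
    rw [(J_deriv hm).deriv]
    exact D_pos hm

lemma mJ_anti {x y : ℝ} (hx : 0 ≤ x) (hxy : x ≤ y) (hy : y < 1) :
    (1 - y) * J y ≤ (1 - x) * J x := by
  have hx1 : x < 1 := lt_of_le_of_lt hxy hy
  have hUx := U_cont hx1
  have hUy := U_cont hy
  rw [J, J, ← intervalIntegral.integral_const_mul, ← intervalIntegral.integral_const_mul]
  apply intervalIntegral.integral_mono_on (by positivity)
  · apply Continuous.intervalIntegrable
    fun_prop
  · apply Continuous.intervalIntegrable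
    fun_prop
  · intro t _
    have h1 := U_sq hx1 t
    have h2 := U_sq hy t
    have p1 := U_pos hx1 t
    have p2 := U_pos hy t
    have d1 := delta_pos hx1 t
    have d2 := delta_pos hy t
    have hs := Real.sin_sq_le_one t
    have hs0 := sq_nonneg (Real.sin t)
    apply le_of_sq_le_sq _ (mul_nonneg (by linarith) p1.le)
    rw [mul_pow, mul_pow, eq_div_of_mul_eq d1.ne' h1, eq_div_of_mul_eq d2.ne' h2,
      mul_one_div, mul_one_div, div_le_div_iff₀ d2 d1]
    generalize Real.sin t ^ 2 = s at *
    have a : (1 - y) * (1 - x * s) ≤ (1 - x) * (1 - y * s) := by nlinarith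
    calc (1 - y) ^ 2 * (1 - x * s) = (1 - y) * ((1 - y) * (1 - x * s)) := by ring
      _ ≤ (1 - x) * ((1 - x) * (1 - y * s)) := by
        apply mul_le_mul (by linarith) a (mul_nonneg (by linarith) d1.le) (by linarith)
      _ = _ := by ring

noncomputable def F (l : ℝ) : ℝ := (1 - l ^ 2) * J (l ^ 2) * J (1 - l ^ 2)

lemma sq_mem {l : ℝ} (hl : l ∈ Ioo (0:ℝ) 1) : l ^ 2 ∈ Ioo (0:ℝ) 1 :=
  ⟨pow_pos hl.1 2, pow_lt_one₀ hl.1.le hl.2 two_ne_zero⟩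

lemma J_pos {m : ℝ} (hm : m ∈ Ioo (0:ℝ) 1) : 0 < J m := by
  have := J_lower hm.1.le hm.2
  have := Real.pi_pos
  linarith

lemma F_anti : StrictAntiOn F (Ioo 0 1) := by
  intro a ha b hb hab
  have hsq : a ^ 2 < b ^ 2 := by
    have := ha.1
    gcongr
  have ha2 := sq_mem ha
  have hb2 := sq_mem hb
  have h1 := mJ_anti ha2.1.le hsq.le hb2.2
  have h2 : J (1 - b ^ 2) < J (1 - a ^ 2) :=
    J_strictMono (by simp only [mem_Iio]; linarith [hb2.1]) (by simp only [mem_Iio]; linarith [ha2.1])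
      (by linarith)
  have p1 := J_pos hb2
  have p2 : 0 < J (1 - b ^ 2) := J_pos ⟨by linarith [hb2.2], by linarith [hb2.1]⟩
  have p3 : 0 < (1 - b ^ 2) * J (b ^ 2) := mul_pos (by linarith [hb2.2]) p1
  have p4 := p2.trans h2
  unfold F
  calc _ < (1 - b ^ 2) * J (b ^ 2) * J (1 - a ^ 2) := by gcongr
    _ ≤ _ := by gcongr

lemma J_sq_deriv {l : ℝ} (hl : l ∈ Ioo (0:ℝ) 1) :
    HasDerivAt (fun l => J (l ^ 2)) (D (l ^ 2) * (2 * l)) l := by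
  have h : HasDerivAt (fun l : ℝ => l ^ 2) (2 * l) l := by simpa using hasDerivAt_pow 2 l
  exact HasDerivAt.comp (h₂ := J) (h := fun l => l ^ 2) l (J_deriv (sq_mem hl).2) h

lemma J_sq_deriv' {l : ℝ} (hl : l ∈ Ioo (0:ℝ) 1) :
    HasDerivAt (fun l => J (1 - l ^ 2)) (D (1 - l ^ 2) * (-(2 * l))) l := by
  have h : HasDerivAt (fun l : ℝ => 1 - l ^ 2) (-(2 * l)) l := by
    simpa using (hasDerivAt_pow 2 l).const_sub 1
  have h1 : 1 - l ^ 2 < 1 := by linarith [(sq_mem hl).1]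
  exact HasDerivAt.comp (h₂ := J) (h := fun l => 1 - l ^ 2) l (J_deriv h1) h

lemma F_cont : ContinuousOn F (Ioo 0 1) := by
  intro l hl
  have h1 := (J_sq_deriv hl).continuousAt
  have h2 := (J_sq_deriv' hl).continuousAt
  have h3 : ContinuousAt (fun l : ℝ => 1 - l ^ 2) l := by fun_prop
  exact ((h3.mul h1).mul h2).continuousWithinAt

lemma exists_zero : ∃ l ∈ Ioo (0:ℝ) 1, F l = Real.pi / 2 := by
  have hpi := Real.pi_gt_three
  have hpi4 := Real.pi_lt_d2
  have h1 : Real.pi / 2 ≤ F (1/2) := by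
    have a := J_lower (m := (1/2) ^ 2) (by norm_num) (by norm_num)
    have b := J_lower (m := 1 - (1/2) ^ 2) (by norm_num) (by norm_num)
    unfold F
    have c := J_pos (m := (1/2) ^ 2) (by constructor <;> norm_num)
    have : Real.pi / 2 * (Real.pi / 2) ≤ J ((1/2) ^ 2) * J (1 - (1/2) ^ 2) := by gcongr
    nlinarith
  have h2 : F (12/13) ≤ Real.pi / 2 := by
    have a := J_upper (m := (12/13) ^ 2) (by norm_num) (by norm_num)
    have b := J_upper (m := 1 - (12/13) ^ 2) (by norm_num) (by norm_num)
    have c := J_pos (m := (12/13) ^ 2) (by constructor <;> norm_num)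
    have d := J_pos (m := 1 - (12/13) ^ 2) (by constructor <;> norm_num)
    rw [show (1 - (12/13) ^ 2 : ℝ) = (5/13) ^ 2 by norm_num] at *
    rw [show (1 - (5/13) ^ 2 : ℝ) = (12/13) ^ 2 by norm_num] at *
    rw [Real.sqrt_sq (by norm_num)] at a b
    unfold F
    rw [show (1 - (12/13) ^ 2 : ℝ) = (5/13) ^ 2 by norm_num]
    have : (5 / 13 * J ((12/13) ^ 2)) * (12 / 13 * J ((5/13) ^ 2))
      ≤ Real.pi / 2 * (Real.pi / 2) := by gcongr
    nlinarith
  obtain ⟨l, hl, e⟩ := intermediate_value_Icc' (by norm_num : (1/2:ℝ) ≤ 12/13)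
    (F_cont.mono (fun x hx => ⟨by linarith [hx.1], by linarith [hx.2]⟩)) ⟨h2, h1⟩
  exact ⟨l, ⟨by linarith [hl.1], by linarith [hl.2]⟩, e⟩

lemma K_compl {l : ℝ} (hl : l ∈ Ioo (0:ℝ) 1) :
    ellipticK (Real.sqrt (1 - l ^ 2)) = J (1 - l ^ 2) := by
  rw [ellipticK_eq, Real.sq_sqrt (by linarith [(sq_mem hl).2])]

lemma g_deriv {l : ℝ} (hl : l ∈ Ioo (0:ℝ) 1) :
    HasDerivAt gfun ((F l - Real.pi / 2) / ((1 - l ^ 2) * J (l ^ 2) ^ 2)) l := by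
  have hJ := J_pos (sq_mem hl)
  have h1 : 0 < 1 - l ^ 2 := by linarith [(sq_mem hl).2]
  have hd := ((hasDerivAt_id l).mul (J_sq_deriv' hl)).div (J_sq_deriv hl) hJ.ne'
  have hL := legendre (sq_mem hl)
  have he : gfun =ᶠ[𝓝 l] (fun l => (id l * J (1 - l ^ 2)) / J (l ^ 2)) := by
    filter_upwards [isOpen_Ioo.mem_nhds hl] with x hx
    rw [gfun, K_compl hx, ellipticK_eq, id]
  refine HasDerivAt.congr_of_eventuallyEq ?_ he
  refine hd.congr_deriv (Eq.symm ?_)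
  rw [div_eq_div_iff (by positivity) (by positivity)]
  simp only [F, id, Pi.mul_apply]
  linear_combination 2 * J (l ^ 2) ^ 2 * hL

end EllAux

theorem exists_unique_max_point :
    ∃ l₀ ∈ Set.Ioo (0:ℝ) 1,
      (1 - l₀ ^ 2) * ellipticK l₀ * ellipticK (Real.sqrt (1 - l₀ ^ 2))
        = Real.pi / 2 ∧
      (∀ l ∈ Set.Ioo (0:ℝ) 1, l ≠ l₀ → gfun l < gfun l₀) ∧
      (∀ l ∈ Set.Ioo (0:ℝ) 1,
        (1 - l ^ 2) * ellipticK l * ellipticK (Real.sqrt (1 - l ^ 2))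
          = Real.pi / 2 → l = l₀) := by
  obtain ⟨l₀, h₀, hF⟩ := EllAux.exists_zero
  have hFe : ∀ l ∈ Set.Ioo (0:ℝ) 1,
      (1 - l ^ 2) * ellipticK l * ellipticK (Real.sqrt (1 - l ^ 2)) = EllAux.F l := by
    intro l hl
    rw [EllAux.K_compl hl, EllAux.ellipticK_eq, EllAux.F]
  have hden : ∀ l ∈ Set.Ioo (0:ℝ) 1, 0 < (1 - l ^ 2) * EllAux.J (l ^ 2) ^ 2 := by
    intro l hl
    have := EllAux.J_pos (EllAux.sq_mem hl)
    have : 0 < 1 - l ^ 2 := by linarith [(EllAux.sq_mem hl).2]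
    positivity
  refine ⟨l₀, h₀, by rw [hFe l₀ h₀, hF], ?_, ?_⟩
  · intro l hl hne
    rcases lt_or_gt_of_ne hne with h | h
    · have hm : StrictMonoOn gfun (Set.Icc l l₀) := by
        apply strictMonoOn_of_deriv_pos (convex_Icc _ _)
        · intro x hx
          exact (EllAux.g_deriv ⟨by linarith [hx.1, hl.1], by linarith [hx.2, h₀.2]⟩).continuousAt.continuousWithinAt
        · intro x hx
          rw [interior_Icc] at hx
          have hx' : x ∈ Set.Ioo (0:ℝ) 1 := ⟨by linarith [hx.1, hl.1], by linarith [hx.2, h₀.2]⟩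
          rw [(EllAux.g_deriv hx').deriv]
          have := EllAux.F_anti hx' h₀ hx.2
          exact div_pos (by linarith) (hden x hx')
      exact hm (Set.left_mem_Icc.mpr h.le) (Set.right_mem_Icc.mpr h.le) h
    · have hm : StrictAntiOn gfun (Set.Icc l₀ l) := by
        apply strictAntiOn_of_deriv_neg (convex_Icc _ _)
        · intro x hx
          exact (EllAux.g_deriv ⟨by linarith [hx.1, h₀.1], by linarith [hx.2, hl.2]⟩).continuousAt.continuousWithinAt
        · intro x hx
          rw [interior_Icc] at hx
          have hx' : x ∈ Set.Ioo (0:ℝ) 1 := ⟨by linarith [hx.1, h₀.1], by linarith [hx.2, hl.2]⟩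
          rw [(EllAux.g_deriv hx').deriv]
          have := EllAux.F_anti h₀ hx' hx.1
          exact div_neg_of_neg_of_pos (by linarith) (hden x hx')
      exact hm (Set.left_mem_Icc.mpr h.le) (Set.right_mem_Icc.mpr h.le) h
  · intro l hl he
    rw [hFe l hl] at he
    exact EllAux.F_anti.injOn hl h₀ (he.trans hF.symm)
end
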